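/- Gotzmann's Persistence Theorem: let k be a field, S = k[x_0,…,x_n] with the standard grading, and I a homogeneous ideal of S generated in degrees at most d, where d ≥ 1. If H(S/I, d+1) = H(S/I, d)^{⟨d⟩}, then H(S/I, s+1) = H(S/I, s)^{⟨s⟩} for all s ≥ d. -/

import Mathlib

/-- The `d`-th Macaulay transform `a^{⟨d⟩}`: writing the (unique, greedy) `d`-th Macaulay
representation `a = C(k_d, d) + C(k_{d-1}, d-1) + ⋯ + C(k_δ, δ)` with
`k_d > k_{d-1} > ⋯ > k_δ ≥ δ ≥ 1`, it is `C(k_d+1, d+1) + ⋯ + C(k_δ+1, δ+1)`;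
by convention `0^{⟨d⟩} = 0`. -/
def macaulayTransform : ℕ → ℕ → ℕ
  | 0, _ => 0
  | _ + 1, 0 => 0
  | d + 1, a + 1 =>
    Nat.choose (Nat.findGreatest (fun k => Nat.choose k (d + 1) ≤ a + 1) (a + d + 2) + 1) (d + 2)
      + macaulayTransform d
          (a + 1 - Nat.choose (Nat.findGreatest (fun k => Nat.choose k (d + 1) ≤ a + 1) (a + d + 2)) (d + 1))

/-- The Hilbert function `H(S/I, m) = dim_k S_m - dim_k (I ∩ S_m)` of the quotient of
`S = k[x_0, …, x_n]` by a (homogeneous) ideal `I`. -/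
noncomputable def hilbertFnQuot (K : Type) [Field K] (n : ℕ)
    (I : Ideal (MvPolynomial (Fin (n+1)) K)) (m : ℕ) : ℕ :=
  Module.finrank K (MvPolynomial.homogeneousSubmodule (Fin (n+1)) K m) -
  Module.finrank K
    (I.restrictScalars K ⊓ MvPolynomial.homogeneousSubmodule (Fin (n+1)) K m :
      Submodule K (MvPolynomial (Fin (n+1)) K))

/-- Every natural number has a leading term in the combinatorial number system of degree `d + 1`. -/
theorem exists_eq_choose_add (d c : ℕ) :
    ∃ k r : ℕ, c = k.choose (d + 1) + r ∧ r < k.choose d := by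
  induction c with
  | zero => exact ⟨d, 0, by simp, by simp⟩
  | succ c ih =>
    obtain ⟨k, r, rfl, hr⟩ := ih
    by_cases h : r + 1 < k.choose d
    · exact ⟨k, r + 1, by ring, h⟩
    · refine ⟨k + 1, 0, ?_, Nat.choose_pos ?_⟩
      · rw [Nat.choose_succ_succ']; omega
      · by_contra! hk
        rw [Nat.choose_eq_zero_of_lt (by omega)] at hr
        omega

theorem findGreatest_choose_le {d k r B : ℕ} (hr : r < k.choose d)
    (hB : k.choose (d + 1) + r + d ≤ B) :
    Nat.findGreatest (fun j => j.choose (d + 1) ≤ k.choose (d + 1) + r) B = k := by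
  rw [Nat.findGreatest_eq_iff]
  have hkd : d ≤ k := by
    by_contra! hk
    rw [Nat.choose_eq_zero_of_lt hk] at hr
    omega
  refine ⟨?_, fun _ => Nat.le_add_right _ _, fun {n} hn _ h => ?_⟩
  · obtain ⟨m, rfl⟩ := Nat.exists_eq_add_of_le hkd
    have : m ≤ (d + m).choose (d + 1) := by
      clear hkd hB hr
      induction m with
      | zero => simp
      | succ m ih =>
        rw [← add_assoc, Nat.choose_succ_succ']
        have := Nat.choose_pos (show d ≤ d + m by omega)
        omega
    omega
  · have := Nat.choose_le_choose (d + 1) (show k + 1 ≤ n from hn)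
    rw [Nat.choose_succ_succ'] at this
    omega

theorem macaulayTransform_zero_right (d : ℕ) : macaulayTransform d 0 = 0 := by
  cases d <;> simp [macaulayTransform]

theorem macaulayTransform_choose_add {d k r : ℕ} (hr : r < k.choose d) :
    macaulayTransform (d + 1) (k.choose (d + 1) + r) =
      (k + 1).choose (d + 1 + 1) + macaulayTransform d r := by
  have hkd : d ≤ k := by
    by_contra! hk
    rw [Nat.choose_eq_zero_of_lt hk] at hr
    omega
  rcases Nat.eq_zero_or_pos (k.choose (d + 1) + r) with h | h
  · obtain ⟨h1, rfl⟩ : k.choose (d + 1) = 0 ∧ r = 0 := by omega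
    rw [h, macaulayTransform_zero_right, macaulayTransform_zero_right,
      Nat.choose_eq_zero_of_lt]
    rw [Nat.choose_eq_zero_iff] at h1
    omega
  · obtain ⟨a, ha⟩ := Nat.exists_eq_succ_of_ne_zero h.ne'
    have hk : Nat.findGreatest (fun j => j.choose (d + 1) ≤ a + 1) (a + d + 2) = k := by
      have := findGreatest_choose_le hr (B := a + d + 2) (by omega)
      rwa [ha] at this
    rw [ha, Nat.succ_eq_add_one, macaulayTransform, hk, ← Nat.succ_eq_add_one a, ← ha,
      Nat.add_sub_cancel_left]

/-- The transform `a_{⟨d⟩}` bounding restrictions to a general hyperplane: it sends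
`C(k_d, d) + ⋯ + C(k_δ, δ)` to `C(k_d - 1, d) + ⋯ + C(k_δ - 1, δ)`. -/
def greenTransform : ℕ → ℕ → ℕ
  | 0, _ => 0
  | d + 1, c =>
    Nat.choose (Nat.findGreatest (fun k => Nat.choose k (d + 1) ≤ c) (c + d) - 1) (d + 1) +
      greenTransform d
        (c - Nat.choose (Nat.findGreatest (fun k => Nat.choose k (d + 1) ≤ c) (c + d)) (d + 1))

theorem greenTransform_choose_add {d k r : ℕ} (hr : r < k.choose d) :
    greenTransform (d + 1) (k.choose (d + 1) + r) =
      (k - 1).choose (d + 1) + greenTransform d r := by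
  rw [greenTransform, findGreatest_choose_le hr le_rfl, Nat.add_sub_cancel_left]

theorem greenTransform_zero_right (d : ℕ) : greenTransform d 0 = 0 := by
  induction d with
  | zero => rfl
  | succ d ih =>
    have := greenTransform_choose_add (d := d) (k := d) (r := 0) (by simp)
    simpa [ih, Nat.choose_eq_zero_of_lt (show d - 1 < d + 1 by omega)] using this

theorem greenTransform_one (c : ℕ) : greenTransform 1 c = c - 1 := by
  simp [greenTransform]

theorem le_of_lt_choose {d k r : ℕ} (hr : r < k.choose d) : d ≤ k := by
  by_contra! hk
  rw [Nat.choose_eq_zero_of_lt hk] at hr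
  omega

theorem lt_of_choose_add_lt {d j k r : ℕ} (h : j.choose d + r < k.choose d) : j < k := by
  by_contra! hk
  have := Nat.choose_le_choose d hk
  omega

theorem macaulayTransform_lt {d k r : ℕ} (hr : r < k.choose d) :
    macaulayTransform d r < (k + 1).choose (d + 1) := by
  induction d generalizing k r with
  | zero => simp [macaulayTransform]
  | succ d ih =>
    obtain ⟨j, q, rfl, hq⟩ := exists_eq_choose_add d r
    rw [macaulayTransform_choose_add hq]
    have h1 := ih hq
    have h2 := Nat.choose_le_choose (d + 1 + 1) (show j + 2 ≤ k + 1 by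
      have := lt_of_choose_add_lt hr
      omega)
    rw [Nat.choose_succ_succ'] at h2
    show _ < (k + 1).choose (d + 1 + 1)
    omega

theorem macaulayTransform_mono (d : ℕ) : Monotone (macaulayTransform d) := by
  induction d with
  | zero => intro a b _; simp [macaulayTransform]
  | succ d ih =>
    intro a b hab
    obtain ⟨j, q, rfl, hq⟩ := exists_eq_choose_add d a
    obtain ⟨k, r, rfl, hr⟩ := exists_eq_choose_add d b
    rw [macaulayTransform_choose_add hr]
    rcases lt_trichotomy j k with h | rfl | h
    · have h1 : j.choose (d + 1) + q < (j + 1).choose (d + 1) := by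
        rw [Nat.choose_succ_succ']; omega
      have h2 := macaulayTransform_lt h1
      have h3 := Nat.choose_le_choose (d + 1 + 1) (show j + 2 ≤ k + 1 by omega)
      exact h2.le.trans (h3.trans (Nat.le_add_right _ _))
    · rw [macaulayTransform_choose_add hq]
      exact Nat.add_le_add_left (ih (by omega)) _
    · have h1 := Nat.choose_le_choose (d + 1) (show k + 1 ≤ j from h)
      rw [Nat.choose_succ_succ'] at h1
      omega

theorem greenTransform_lt {d k r : ℕ} (hr : r < k.choose d) (hdk : d < k) :
    greenTransform d r < (k - 1).choose d := by
  induction d generalizing k r with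
  | zero => simp [greenTransform]
  | succ d ih =>
    obtain ⟨j, q, rfl, hq⟩ := exists_eq_choose_add d r
    have hjk := lt_of_choose_add_lt hr
    rcases (le_of_lt_choose hq).eq_or_lt with rfl | hdj
    · obtain rfl : q = 0 := by simpa using hq
      simp only [Nat.choose_succ_self, add_zero, greenTransform_zero_right]
      exact Nat.choose_pos (by omega)
    · rw [greenTransform_choose_add hq]
      have h1 := ih hq hdj
      have h2 := Nat.choose_le_choose (d + 1) (show j - 1 + 1 ≤ k - 1 by omega)
      rw [Nat.choose_succ_succ'] at h2
      omega

theorem greenTransform_choose (d k : ℕ) :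
    greenTransform (d + 1) (k.choose (d + 1)) = (k - 1).choose (d + 1) := by
  by_cases h : d ≤ k
  · have := greenTransform_choose_add (k := k) (Nat.choose_pos h)
    simpa [greenTransform_zero_right] using this
  · rw [Nat.choose_eq_zero_of_lt (by omega), Nat.choose_eq_zero_of_lt (by omega),
      greenTransform_zero_right]

theorem macaulayTransform_choose (d k : ℕ) :
    macaulayTransform (d + 1) (k.choose (d + 1)) = (k + 1).choose (d + 1 + 1) := by
  by_cases h : d ≤ k
  · have := macaulayTransform_choose_add (k := k) (Nat.choose_pos h)
    simpa [macaulayTransform_zero_right] using this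
  · rw [Nat.choose_eq_zero_of_lt (by omega), Nat.choose_eq_zero_of_lt (by omega),
      macaulayTransform_zero_right]

theorem greenTransform_mono (d : ℕ) : Monotone (greenTransform d) := by
  induction d with
  | zero => intro a b _; simp [greenTransform]
  | succ d ih =>
    intro a b hab
    obtain ⟨j, q, rfl, hq⟩ := exists_eq_choose_add d a
    obtain ⟨k, r, rfl, hr⟩ := exists_eq_choose_add d b
    rw [greenTransform_choose_add hr]
    rcases lt_trichotomy j k with h | rfl | h
    · have h1 : j.choose (d + 1) + q < (j + 1).choose (d + 1) := by
        rw [Nat.choose_succ_succ']; omega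
      rcases (le_of_lt_choose hq).eq_or_lt with rfl | hdj
      · obtain rfl : q = 0 := by simpa using hq
        simp [greenTransform_zero_right]
      · have h2 := greenTransform_lt h1 (by omega)
        have h3 := Nat.choose_le_choose (d + 1) (show j + 1 - 1 ≤ k - 1 by omega)
        omega
    · rw [greenTransform_choose_add hq]
      exact Nat.add_le_add_left (ih (by omega)) _
    · have h1 := Nat.choose_le_choose (d + 1) (show k + 1 ≤ j from h)
      rw [Nat.choose_succ_succ'] at h1
      omega

theorem greenTransform_le (d c : ℕ) : greenTransform d c ≤ c := by
  induction d generalizing c with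
  | zero => simp [greenTransform]
  | succ d ih =>
    obtain ⟨j, q, rfl, hq⟩ := exists_eq_choose_add d c
    rw [greenTransform_choose_add hq]
    exact Nat.add_le_add (Nat.choose_le_choose _ (Nat.sub_le _ _)) (ih q)

theorem le_greenTransform_add_choose {d k r : ℕ} (hr : r < k.choose (d + 1)) :
    r ≤ greenTransform (d + 1) (r + k.choose d) := by
  induction d generalizing k r with
  | zero => simp [greenTransform_one]
  | succ d ih =>
    obtain ⟨j, q, rfl, hq⟩ := exists_eq_choose_add (d + 1) r
    have hjk := lt_of_choose_add_lt hr
    have h1 := Nat.choose_le_choose (d + 1) (show j + 1 ≤ k from hjk)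
    have h2 : q + j.choose d < (j + 1).choose (d + 1) := by
      rw [Nat.choose_succ_succ']; omega
    have h3 := greenTransform_choose_add h2
    have h4 := ih hq
    rw [Nat.choose_succ_succ'] at h1
    refine le_trans ?_ (greenTransform_mono _ (show
      (j + 1).choose (d + 1 + 1) + (q + j.choose d) ≤ _ from ?_))
    · rw [h3, Nat.add_sub_cancel]; omega
    · rw [Nat.choose_succ_succ']; omega

theorem le_greenTransform_of_le_add {d b e : ℕ}
    (h : b ≤ greenTransform (d + 1) b + greenTransform d e) :
    b ≤ greenTransform (d + 1) (b + e) := by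
  induction d generalizing b e with
  | zero =>
    rw [zero_add, greenTransform_one] at *
    simp only [greenTransform] at h
    omega
  | succ d ih =>
    rcases Nat.eq_zero_or_pos b with rfl | hb
    · exact Nat.zero_le _
    obtain ⟨k, r, rfl, hr⟩ := exists_eq_choose_add (d + 1) b
    have hk := le_of_lt_choose hr
    obtain ⟨k, rfl⟩ := Nat.exists_eq_add_of_le' (show 1 ≤ k by omega)
    have hrG := greenTransform_le (d + 1) r
    rw [greenTransform_choose_add hr, Nat.add_sub_cancel, Nat.choose_succ_succ'] at h
    have hle : (k + 1).choose (d + 1) ≤ e := by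
      by_contra! hlt
      rcases hk.eq_or_lt with hk | hk
      · obtain rfl : k = d := by omega
        simp only [Nat.choose_self, Nat.lt_one_iff] at hr hlt
        subst hr
        simp at hb
      · have := greenTransform_lt hlt hk
        rw [Nat.add_sub_cancel] at this
        omega
    obtain ⟨e', rfl⟩ := Nat.exists_eq_add_of_le hle
    have hsum : (k + 1).choose (d + 1 + 1) + r + ((k + 1).choose (d + 1) + e') =
        (k + 2).choose (d + 1 + 1) + (r + e') := by
      rw [Nat.choose_succ_succ' (k + 1) (d + 1)]; ring
    show (k + 1).choose (d + 1 + 1) + r ≤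
      greenTransform (d + 2) ((k + 1).choose (d + 1 + 1) + r + _)
    rw [hsum]
    by_cases hbig : (k + 2).choose (d + 1) ≤ r + e'
    · refine le_trans ?_ (greenTransform_mono _ (show (k + 3).choose (d + 1 + 1) ≤ _ from ?_))
      · rw [greenTransform_choose]
        show _ ≤ (k + 2).choose (d + 1 + 1)
        rw [Nat.choose_succ_succ' (k + 1) (d + 1)]
        omega
      · rw [Nat.choose_succ_succ' (k + 2) (d + 1)]
        omega
    · rw [greenTransform_choose_add (by omega)]
      refine Nat.add_le_add_left ?_ _
      by_cases he : e' < (k + 1).choose d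
      · apply ih
        rw [greenTransform_choose_add he, Nat.add_sub_cancel] at h
        omega
      · exact (le_greenTransform_add_choose hr).trans (greenTransform_mono _ (by omega))

theorem le_macaulayTransform_of_le_add {d b c : ℕ} (h0 : d = 0 → c = 0)
    (h : b ≤ c + greenTransform (d + 1) b) : b ≤ macaulayTransform d c := by
  induction d generalizing b c with
  | zero =>
    simp only [zero_add, greenTransform_one, h0] at h
    omega
  | succ d ih =>
    rcases Nat.eq_zero_or_pos b with rfl | hb
    · exact Nat.zero_le _
    obtain ⟨k, r, rfl, hr⟩ := exists_eq_choose_add (d + 1) b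
    have hk := le_of_lt_choose hr
    obtain ⟨k, rfl⟩ := Nat.exists_eq_add_of_le' (show 1 ≤ k by omega)
    have hrG := greenTransform_le (d + 1) r
    rw [greenTransform_choose_add hr, Nat.add_sub_cancel, Nat.choose_succ_succ'] at h
    by_cases hc : (k + 1).choose (d + 1) ≤ c
    · refine le_trans ?_ (macaulayTransform_mono _ hc)
      rw [macaulayTransform_choose, Nat.choose_succ_succ' (k + 1) (d + 1)]
      show (k + 1).choose (d + 1 + 1) + r ≤ _
      omega
    · rw [Nat.choose_succ_succ'] at hc
      obtain ⟨q, rfl⟩ := Nat.exists_eq_add_of_le (show k.choose (d + 1) ≤ c by omega)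
      have hq : q < k.choose d := by omega
      rw [macaulayTransform_choose_add hq]
      refine Nat.add_le_add_left (ih ?_ (by omega)) _
      rintro rfl
      simpa using hq

theorem macaulayTransform_eq_add_greenTransform {d c : ℕ} (h0 : d = 0 → c = 0) :
    macaulayTransform d c = c + greenTransform (d + 1) (macaulayTransform d c) := by
  induction d generalizing c with
  | zero => simp [macaulayTransform, greenTransform_zero_right, h0]
  | succ d ih =>
    obtain ⟨k, r, rfl, hr⟩ := exists_eq_choose_add d c
    rw [macaulayTransform_choose_add hr, greenTransform_choose_add (macaulayTransform_lt hr),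
      Nat.add_sub_cancel, Nat.choose_succ_succ']
    have := ih (c := r) (by rintro rfl; simpa using hr)
    omega

theorem macaulayTransform_greenTransform (d c : ℕ) :
    macaulayTransform d (greenTransform d c) = greenTransform (d + 1) (macaulayTransform d c) := by
  induction d generalizing c with
  | zero => simp [macaulayTransform, greenTransform_zero_right]
  | succ d ih =>
    obtain ⟨k, r, rfl, hr⟩ := exists_eq_choose_add d c
    rcases (le_of_lt_choose hr).eq_or_lt with rfl | hdk
    · obtain rfl : r = 0 := by simpa using hr
      simp [greenTransform_zero_right, macaulayTransform_zero_right]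
    rw [macaulayTransform_choose_add hr, greenTransform_choose_add (macaulayTransform_lt hr),
      greenTransform_choose_add hr, macaulayTransform_choose_add (greenTransform_lt hr hdk), ih,
      Nat.add_sub_cancel, Nat.sub_add_cancel (by omega)]

section Forms

open MvPolynomial

variable {K : Type*} [Field K] {n : ℕ}

/-- The space of forms of degree `d` in `n` variables. -/
noncomputable abbrev forms (K : Type*) [Field K] (n d : ℕ) : Submodule K (MvPolynomial (Fin n) K) :=
  homogeneousSubmodule (Fin n) K d

instance finiteDimensional_forms (d : ℕ) : FiniteDimensional K (forms K n d) :=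
  Module.Finite.iff_fg.mpr (homogeneousSubmodule_fg _ _ d)

theorem finiteDimensional_of_le_forms {d : ℕ} {W : Submodule K (MvPolynomial (Fin n) K)}
    (hW : W ≤ forms K n d) : FiniteDimensional K W :=
  Submodule.finiteDimensional_of_le hW

theorem forms_mul_forms (i j : ℕ) : forms K n i * forms K n j = forms K n (i + j) := by
  rw [forms, forms, forms, ← homogeneousSubmodule_one_pow _ i, ← homogeneousSubmodule_one_pow _ j,
    ← pow_add, homogeneousSubmodule_one_pow]

theorem finrank_forms_zero : Module.finrank K (forms K n 0) = 1 := by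
  rw [forms, homogeneousSubmodule_zero, Submodule.one_eq_span]
  exact finrank_span_singleton one_ne_zero

theorem forms_zero_vars (d : ℕ) : forms K 0 (d + 1) = ⊥ := by
  rw [eq_bot_iff]
  intro p hp
  by_contra h
  have := IsHomogeneous.inj_right (isHomogeneous_of_isEmpty _ K p) hp h
  omega

/-- The linear form with coefficients `a`. -/
noncomputable def linearForm (a : Fin n → K) : MvPolynomial (Fin n) K :=
  ∑ i, a i • X i

theorem linearForm_mem (a : Fin n → K) : linearForm a ∈ forms K n 1 :=
  Submodule.sum_mem _ fun i _ => Submodule.smul_mem _ _ (isHomogeneous_X K i)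

theorem linearForm_add (a b : Fin n → K) : linearForm (a + b) = linearForm a + linearForm b := by
  simp [linearForm, add_smul, Finset.sum_add_distrib]

theorem linearForm_smul (c : K) (a : Fin n → K) : linearForm (c • a) = c • linearForm a := by
  simp [linearForm, mul_smul, Finset.smul_sum]

/-- The equation `x₀ - ∑ aᵢ xᵢ₊₁` of the hyperplane with parameter `a`. -/
noncomputable def hyperplaneForm (a : Fin n → K) : MvPolynomial (Fin (n + 1)) K :=
  linearForm (Fin.cons 1 (-a))

theorem hyperplaneForm_mem (a : Fin n → K) : hyperplaneForm a ∈ forms K (n + 1) 1 :=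
  linearForm_mem _

theorem hyperplaneForm_eq (a : Fin n → K) :
    hyperplaneForm a = X 0 - rename Fin.succ (linearForm a) := by
  simp [hyperplaneForm, linearForm, Fin.sum_univ_succ, sub_eq_add_neg]

/-- Restriction of polynomials to the hyperplane with parameter `a`. -/
noncomputable def restrictTo (a : Fin n → K) :
    MvPolynomial (Fin (n + 1)) K →ₐ[K] MvPolynomial (Fin n) K :=
  aeval (Fin.cons (linearForm a) X)

@[simp]
theorem restrictTo_X_zero (a : Fin n → K) : restrictTo a (X 0) = linearForm a := by
  simp [restrictTo]

@[simp]
theorem restrictTo_X_succ (a : Fin n → K) (i : Fin n) : restrictTo a (X i.succ) = X i := by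
  simp [restrictTo]

@[simp]
theorem restrictTo_rename (a : Fin n → K) (p : MvPolynomial (Fin n) K) :
    restrictTo a (rename Fin.succ p) = p := by
  rw [restrictTo, aeval_rename]
  have : (Fin.cons (linearForm a) X : Fin (n + 1) → MvPolynomial (Fin n) K) ∘ Fin.succ = X := by
    ext i; simp
  rw [this, aeval_X_left_apply]

@[simp]
theorem restrictTo_hyperplaneForm (a : Fin n → K) : restrictTo a (hyperplaneForm a) = 0 := by
  simp [hyperplaneForm_eq]

theorem hyperplaneForm_ne_zero (a : Fin n → K) : hyperplaneForm a ≠ 0 := by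
  intro h
  have h1 := congrArg (aeval (Fin.cons (1 : K) 0 : Fin (n + 1) → K)) h
  simp [hyperplaneForm, linearForm, Fin.sum_univ_succ] at h1

theorem hyperplaneForm_dvd_sub (a : Fin n → K) (p : MvPolynomial (Fin (n + 1)) K) :
    hyperplaneForm a ∣ p - rename Fin.succ (restrictTo a p) := by
  induction p using MvPolynomial.induction_on with
  | C c => simp [← algebraMap_eq]
  | add p q hp hq =>
    rw [map_add, map_add, add_sub_add_comm]
    exact dvd_add hp hq
  | mul_X p i hp =>
    have hX : hyperplaneForm a ∣ X i - rename Fin.succ (restrictTo a (X i)) := by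
      refine Fin.cases ?_ (fun j => ?_) i
      · rw [restrictTo_X_zero, hyperplaneForm_eq]
      · simp
    rw [map_mul, map_mul]
    have := dvd_add (hp.mul_right (X i)) (hX.mul_left (rename Fin.succ (restrictTo a p)))
    convert this using 1
    ring

theorem rename_succ_mem {d : ℕ} {p : MvPolynomial (Fin n) K} (hp : p ∈ forms K n d) :
    rename Fin.succ p ∈ forms K (n + 1) d :=
  IsHomogeneous.rename_isHomogeneous hp

theorem restrictTo_mem (a : Fin n → K) {d : ℕ} {p : MvPolynomial (Fin (n + 1)) K}
    (hp : p ∈ forms K (n + 1) d) : restrictTo a p ∈ forms K n d := by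
  have := IsHomogeneous.aeval (n := 1) hp
    (Fin.cons (linearForm a) X : Fin (n + 1) → MvPolynomial (Fin n) K)
    (fun i => by
      refine Fin.cases ?_ (fun j => ?_) i
      · exact linearForm_mem a
      · exact isHomogeneous_X K j)
  rwa [one_mul] at this

theorem map_restrictTo_forms (a : Fin n → K) (d : ℕ) :
    (forms K (n + 1) d).map (restrictTo a).toLinearMap = forms K n d := by
  apply le_antisymm
  · rintro _ ⟨p, hp, rfl⟩
    exact restrictTo_mem a hp
  · intro p hp
    exact ⟨_, rename_succ_mem hp, restrictTo_rename a p⟩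

theorem exists_eq_hyperplaneForm_mul {a : Fin n → K} {d : ℕ} {p : MvPolynomial (Fin (n + 1)) K}
    (hp : p ∈ forms K (n + 1) (d + 1)) (h : restrictTo a p = 0) :
    ∃ q ∈ forms K (n + 1) d, p = hyperplaneForm a * q := by
  obtain ⟨q, hq⟩ := hyperplaneForm_dvd_sub a p
  rw [h, map_zero, sub_zero] at hq
  refine ⟨homogeneousComponent d q, homogeneousComponent_mem d q, ?_⟩
  let _ := MvPolynomial.gradedAlgebra (σ := Fin (n + 1)) (R := K)
  have := DirectSum.coe_decompose_mul_add_of_left_mem (homogeneousSubmodule (Fin (n + 1)) K)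
    (j := d) (b := q) (hyperplaneForm_mem a)
  rw [← hq, add_comm 1 d, DirectSum.decompose_of_mem_same _ hp] at this
  rw [this]
  congr 1
  exact (MvPolynomial.decomposition.decompose'_apply q d)

/-- The forms `p` of degree `d` with `h * p ∈ W`. -/
noncomputable def colonForms (h : MvPolynomial (Fin n) K) (W : Submodule K (MvPolynomial (Fin n) K))
    (d : ℕ) : Submodule K (MvPolynomial (Fin n) K) :=
  W.comap (LinearMap.mulLeft K h) ⊓ forms K n d

theorem mem_colonForms {h p : MvPolynomial (Fin n) K} {W : Submodule K (MvPolynomial (Fin n) K)}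
    {d : ℕ} : p ∈ colonForms h W d ↔ h * p ∈ W ∧ p ∈ forms K n d := Iff.rfl

theorem colonForms_le {h : MvPolynomial (Fin n) K} {W : Submodule K (MvPolynomial (Fin n) K)}
    {d : ℕ} : colonForms h W d ≤ forms K n d := inf_le_right

theorem finrank_map_restrictTo_add (a : Fin n → K) {d : ℕ}
    {W : Submodule K (MvPolynomial (Fin (n + 1)) K)} (hW : W ≤ forms K (n + 1) (d + 1)) :
    Module.finrank K (W.map (restrictTo a).toLinearMap) +
      Module.finrank K (colonForms (hyperplaneForm a) W d) = Module.finrank K W := by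
  have := finiteDimensional_of_le_forms hW
  have h1 := LinearMap.finrank_range_add_finrank_ker ((restrictTo a).toLinearMap.domRestrict W)
  rw [LinearMap.range_domRestrict] at h1
  rw [← h1]
  congr 1
  have hinj : Function.Injective (LinearMap.mulLeft K (hyperplaneForm a)) :=
    fun x y hxy => mul_left_cancel₀ (hyperplaneForm_ne_zero a) hxy
  rw [(Submodule.equivMapOfInjective _ hinj (colonForms (hyperplaneForm a) W d)).finrank_eq,
    (Submodule.equivMapOfInjective W.subtype W.injective_subtype _).finrank_eq]
  have : (colonForms (hyperplaneForm a) W d).map (LinearMap.mulLeft K (hyperplaneForm a)) =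
      (LinearMap.ker ((restrictTo a).toLinearMap.domRestrict W)).map W.subtype := by
    ext p
    constructor
    · rintro ⟨q, ⟨hq, -⟩, rfl⟩
      refine ⟨⟨_, hq⟩, ?_, rfl⟩
      simp
    · rintro ⟨⟨q, hq⟩, hq', rfl⟩
      obtain ⟨r, hr, rfl⟩ := exists_eq_hyperplaneForm_mul (hW hq) (by simpa using hq')
      exact ⟨r, ⟨hq, hr⟩, rfl⟩
  rw [this]

theorem finrank_forms_succ_succ (n d : ℕ) :
    Module.finrank K (forms K (n + 1) (d + 1)) =
      Module.finrank K (forms K n (d + 1)) + Module.finrank K (forms K (n + 1) d) := by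
  have h := finrank_map_restrictTo_add (0 : Fin n → K) (le_refl (forms K (n + 1) (d + 1)))
  rw [map_restrictTo_forms] at h
  rw [← h]
  congr 1
  have : colonForms (hyperplaneForm (0 : Fin n → K)) (forms K (n + 1) (d + 1)) d =
      forms K (n + 1) d := by
    refine le_antisymm colonForms_le fun p hp => ⟨?_, hp⟩
    have := Submodule.mul_mem_mul (hyperplaneForm_mem (0 : Fin n → K)) hp
    rwa [forms_mul_forms, add_comm 1 d] at this
  rw [this]

/-- The codimension of a space of forms of degree `d`. -/
noncomputable def codimForms (d : ℕ) (W : Submodule K (MvPolynomial (Fin n) K)) : ℕ :=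
  Module.finrank K (forms K n d) - Module.finrank K W

theorem finrank_add_codimForms {d : ℕ} {W : Submodule K (MvPolynomial (Fin n) K)}
    (hW : W ≤ forms K n d) :
    Module.finrank K W + codimForms d W = Module.finrank K (forms K n d) :=
  Nat.add_sub_of_le (Submodule.finrank_mono hW)

theorem codimForms_anti {d : ℕ} {V W : Submodule K (MvPolynomial (Fin n) K)}
    (h : V ≤ W) (hW : W ≤ forms K n d) : codimForms d W ≤ codimForms d V := by
  have := finiteDimensional_of_le_forms hW
  exact Nat.sub_le_sub_left (Submodule.finrank_mono h) _

theorem codimForms_zero_vars (d : ℕ) (W : Submodule K (MvPolynomial (Fin 0) K)) :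
    codimForms (d + 1) W = 0 := by
  rw [codimForms, forms_zero_vars]
  simp

theorem map_restrictTo_le (a : Fin n → K) {d : ℕ} {W : Submodule K (MvPolynomial (Fin (n + 1)) K)}
    (hW : W ≤ forms K (n + 1) d) : W.map (restrictTo a).toLinearMap ≤ forms K n d :=
  (Submodule.map_mono hW).trans (map_restrictTo_forms a d).le

theorem codimForms_eq_add (a : Fin n → K) {d : ℕ}
    {W : Submodule K (MvPolynomial (Fin (n + 1)) K)} (hW : W ≤ forms K (n + 1) (d + 1)) :
    codimForms (d + 1) W = codimForms (d + 1) (W.map (restrictTo a).toLinearMap) +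
      codimForms d (colonForms (hyperplaneForm a) W d) := by
  have h1 := finrank_map_restrictTo_add a hW
  have h2 := finrank_forms_succ_succ (K := K) n d
  have h3 := finrank_add_codimForms hW
  have h4 := finrank_add_codimForms (map_restrictTo_le a hW)
  have h5 := finrank_add_codimForms (colonForms_le (h := hyperplaneForm a) (W := W) (d := d))
  omega

end Forms

section LineOpen

variable {K : Type*} [Field K] {P : Type*} [AddCommGroup P] [Module K P]

/-- A scalar function that is polynomial along every line. -/
def PolyOnLines (K : Type*) {P : Type*} [Field K] [AddCommGroup P] [Module K P]
    (f : P → K) : Prop :=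
  ∀ x v : P, ∃ p : Polynomial K, ∀ t : K, f (x + t • v) = p.eval t

theorem PolyOnLines.const (c : K) : PolyOnLines K (fun _ : P => c) :=
  fun _ _ => ⟨Polynomial.C c, by simp⟩

theorem PolyOnLines.linear (f : P →ₗ[K] K) : PolyOnLines K (fun x => f x) :=
  fun x v => ⟨Polynomial.C (f x) + Polynomial.C (f v) * Polynomial.X, fun t => by simp [mul_comm t]⟩

theorem PolyOnLines.add {f g : P → K} (hf : PolyOnLines K f) (hg : PolyOnLines K g) :
    PolyOnLines K (fun x => f x + g x) := fun x v => by
  obtain ⟨p, hp⟩ := hf x v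
  obtain ⟨q, hq⟩ := hg x v
  exact ⟨p + q, by simp [hp, hq]⟩

theorem PolyOnLines.mul {f g : P → K} (hf : PolyOnLines K f) (hg : PolyOnLines K g) :
    PolyOnLines K (fun x => f x * g x) := fun x v => by
  obtain ⟨p, hp⟩ := hf x v
  obtain ⟨q, hq⟩ := hg x v
  exact ⟨p * q, by simp [hp, hq]⟩

theorem PolyOnLines.sum {ι : Type*} {s : Finset ι} {f : ι → P → K}
    (hf : ∀ i ∈ s, PolyOnLines K (f i)) : PolyOnLines K (fun x => ∑ i ∈ s, f i x) := by
  classical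
  induction s using Finset.induction_on with
  | empty => simpa using PolyOnLines.const (P := P) (0 : K)
  | insert i s hi ih =>
    simp only [Finset.sum_insert hi]
    exact (hf i (by simp)).add (ih fun j hj => hf j (by simp [hj]))

theorem PolyOnLines.prod {ι : Type*} {s : Finset ι} {f : ι → P → K}
    (hf : ∀ i ∈ s, PolyOnLines K (f i)) : PolyOnLines K (fun x => ∏ i ∈ s, f i x) := by
  classical
  induction s using Finset.induction_on with
  | empty => simpa using PolyOnLines.const (P := P) (1 : K)
  | insert i s hi ih =>
    simp only [Finset.prod_insert hi]
    exact (hf i (by simp)).mul (ih fun j hj => hf j (by simp [hj]))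

/-- A set that meets every line in the empty set or the complement of a finite set. -/
def LineOpen (K : Type*) {P : Type*} [Field K] [AddCommGroup P] [Module K P]
    (U : Set P) : Prop :=
  ∀ x ∈ U, ∀ v : P, {t : K | x + t • v ∉ U}.Finite

theorem LineOpen.inter {U V : Set P} (hU : LineOpen K U) (hV : LineOpen K V) :
    LineOpen K (U ∩ V) := fun x hx v => by
  refine ((hU x hx.1 v).union (hV x hx.2 v)).subset fun t ht => ?_
  by_contra h
  simp only [Set.mem_union, Set.mem_ofPred_eq, not_or, not_not] at h
  exact ht h

theorem LineOpen.inter_nonempty [Infinite K] {U V : Set P} (hU : LineOpen K U)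
    (hV : LineOpen K V) (hU' : U.Nonempty) (hV' : V.Nonempty) : (U ∩ V).Nonempty := by
  obtain ⟨x, hx⟩ := hU'
  obtain ⟨y, hy⟩ := hV'
  obtain ⟨t, ht⟩ := ((hU x hx (y - x)).union
    ((hV y hy (x - y)).preimage (sub_right_injective (b := (1 : K))).injOn)).exists_notMem
  simp only [Set.mem_union, Set.mem_ofPred_eq, Set.mem_preimage, not_or, not_not] at ht
  refine ⟨x + t • (y - x), ht.1, ?_⟩
  convert ht.2 using 1
  module

theorem PolyOnLines.lineOpen {f : P → K} (hf : PolyOnLines K f) : LineOpen K {x | f x ≠ 0} := by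
  intro x hx v
  obtain ⟨p, hp⟩ := hf x v
  have hp0 : p ≠ 0 := by
    rintro rfl
    have := hp 0
    simp at this
    exact hx this
  classical
  refine (p.roots.toFinset.finite_toSet).subset fun t ht => ?_
  simp only [Set.mem_ofPred_eq, not_not, hp] at ht
  simpa [hp0] using ht

theorem lineOpen_le_finrank_map {E F : Type*} [AddCommGroup E] [Module K E] [AddCommGroup F]
    [Module K F] {Φ : P → E →ₗ[K] F}
    (hΦ : ∀ (l : F →ₗ[K] K) (e : E), PolyOnLines K (fun x => l (Φ x e)))
    (W : Submodule K E) [FiniteDimensional K W] (r : ℕ) :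
    LineOpen K {x | r ≤ Module.finrank K (W.map (Φ x))} := by
  intro x hx v
  obtain ⟨y, hy⟩ := exists_linearIndependent_of_le_finrank (R := K) hx
  choose w hwW hw using fun i => (y i).2
  have hy' : LinearIndependent K fun i => Φ x (w i) := by
    have := hy.map' (Submodule.subtype _) (Submodule.ker_subtype _)
    rwa [show ⇑(Submodule.map (Φ x) W).subtype ∘ y = fun i => Φ x (w i) from
      funext fun i => (hw i).symm] at this
  obtain ⟨L, hL⟩ := LinearMap.exists_leftInverse_of_injective _
    (LinearMap.ker_eq_bot.mpr hy')
  let f : P → K := fun z => (Matrix.of fun i j => L (Φ z (w i)) j).det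
  have hf : PolyOnLines K f := by
    simp only [f, Matrix.det_apply']
    refine PolyOnLines.sum fun σ _ => (PolyOnLines.const _).mul (PolyOnLines.prod fun i _ => ?_)
    exact hΦ (Finsupp.lapply i ∘ₗ L) (w (σ i))
  have hfx : f x ≠ 0 := by
    have : (Matrix.of fun i j => L (Φ x (w i)) j) = 1 := by
      ext i j
      have h := DFunLike.congr_fun hL (Finsupp.single i 1)
      simp only [LinearMap.comp_apply, Finsupp.linearCombination_single, one_smul,
        LinearMap.id_apply] at h
      simp [h, Matrix.one_apply, Finsupp.single_apply]
    simp [f, this]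
  refine (hf.lineOpen x hfx v).subset fun t ht htf => ht ?_
  have h1 := Matrix.linearIndependent_rows_of_det_ne_zero htf
  have h2 : LinearIndependent K fun i => (⟨Φ (x + t • v) (w i), w i, hwW i, rfl⟩ :
      W.map (Φ (x + t • v))) := by
    refine LinearIndependent.of_comp ((Finsupp.lcoeFun ∘ₗ L) ∘ₗ Submodule.subtype _) ?_
    exact h1
  simpa using h2.fintype_card_le_finrank

end LineOpen

section Green

open MvPolynomial

variable {K : Type*} [Field K] {P : Type*} [AddCommGroup P] [Module K P]

/-- A family of linear substitutions whose coefficients are polynomial along lines. -/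
def LinearlyParametrized {m k : ℕ}
    (Ψ : P → MvPolynomial (Fin m) K →ₐ[K] MvPolynomial (Fin k) K) : Prop :=
  ∃ c : Fin m → Fin k → P → K, (∀ i j, PolyOnLines K (c i j)) ∧
    ∀ x i, Ψ x (X i) = linearForm (fun j => c i j x)

theorem LinearlyParametrized.polyOnLines {m k : ℕ}
    {Ψ : P → MvPolynomial (Fin m) K →ₐ[K] MvPolynomial (Fin k) K} (hΨ : LinearlyParametrized Ψ)
    (l : MvPolynomial (Fin k) K →ₗ[K] K) (p : MvPolynomial (Fin m) K) :
    PolyOnLines K (fun x => l (Ψ x p)) := by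
  obtain ⟨c, hc, hΨ⟩ := hΨ
  induction p using MvPolynomial.induction_on generalizing l with
  | C r => simpa [← algebraMap_eq] using PolyOnLines.const (P := P) (l (algebraMap K _ r))
  | add p q hp hq => simpa using (hp l).add (hq l)
  | mul_X p i hp =>
    simp only [map_mul, hΨ, linearForm, Finset.mul_sum, map_sum, mul_smul_comm, map_smul,
      smul_eq_mul]
    exact PolyOnLines.sum fun j _ => (hc i j).mul (hp (l ∘ₗ LinearMap.mulRight K (X j)))

theorem LinearlyParametrized.comp {m k r : ℕ}
    {Ψ : P → MvPolynomial (Fin m) K →ₐ[K] MvPolynomial (Fin k) K}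
    {Θ : P → MvPolynomial (Fin k) K →ₐ[K] MvPolynomial (Fin r) K}
    (hΘ : LinearlyParametrized Θ) (hΨ : LinearlyParametrized Ψ) :
    LinearlyParametrized (fun x => (Θ x).comp (Ψ x)) := by
  obtain ⟨c, hc, hΨ⟩ := hΨ
  obtain ⟨e, he, hΘ⟩ := hΘ
  refine ⟨fun i j x => ∑ l, c i l x * e l j x,
    fun i j => PolyOnLines.sum fun l _ => (hc i l).mul (he l j), fun x i => ?_⟩
  simp only [AlgHom.comp_apply, hΨ, linearForm, map_sum, map_smul, hΘ, Finset.smul_sum,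
    Finset.sum_smul, mul_smul]
  exact Finset.sum_comm

theorem linearlyParametrized_restrictTo {n : ℕ} {α : P → Fin n → K}
    (hα : ∀ i, PolyOnLines K (fun x => α x i)) :
    LinearlyParametrized (fun x => restrictTo (α x)) := by
  refine ⟨Fin.cons (fun j x => α x j) (fun i j _ => if j = i then 1 else 0), ?_, ?_⟩
  · intro i j
    refine Fin.cases ?_ (fun i => ?_) i
    · exact hα j
    · exact PolyOnLines.const _
  · intro x i
    refine Fin.cases ?_ (fun i => ?_) i
    · simp
    · simp [linearForm]

theorem LinearlyParametrized.lineOpen {m k : ℕ}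
    {Ψ : P → MvPolynomial (Fin m) K →ₐ[K] MvPolynomial (Fin k) K} (hΨ : LinearlyParametrized Ψ)
    {e : ℕ} {W : Submodule K (MvPolynomial (Fin m) K)} (hW : W ≤ forms K m e) (d r : ℕ) :
    LineOpen K {x | codimForms d (W.map (Ψ x).toLinearMap) ≤ r} := by
  have := finiteDimensional_of_le_forms hW
  have h := lineOpen_le_finrank_map (Φ := fun x => (Ψ x).toLinearMap) hΨ.polyOnLines W
    (Module.finrank K (forms K k d) - r)
  convert h using 1
  ext x
  simp only [codimForms, Set.mem_ofPred_eq]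
  omega

theorem lineOpen_codimForms_restrictTo {n e : ℕ} {W : Submodule K (MvPolynomial (Fin (n + 1)) K)}
    (hW : W ≤ forms K (n + 1) e) (d r : ℕ) :
    LineOpen K {a : Fin n → K | codimForms d (W.map (restrictTo a).toLinearMap) ≤ r} :=
  (linearlyParametrized_restrictTo (α := fun a : Fin n → K => a) fun i =>
    PolyOnLines.linear (LinearMap.proj (R := K) (φ := fun _ => K) i)).lineOpen hW d r

theorem exists_hyperplaneForm_notMem {n : ℕ} {W : Submodule K (MvPolynomial (Fin (n + 1)) K)}
    (hW : ¬ forms K (n + 1) 1 ≤ W) : ∃ a : Fin n → K, hyperplaneForm a ∉ W := by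
  by_contra! h
  refine hW ?_
  rw [forms, homogeneousSubmodule_one_eq_span_X, Submodule.span_le]
  have h0 := h 0
  rintro _ ⟨i, rfl⟩
  refine Fin.cases ?_ (fun i => ?_) i
  · simpa [hyperplaneForm_eq, linearForm] using h0
  · have := W.sub_mem h0 (h (Pi.single i 1))
    simpa [hyperplaneForm_eq, linearForm, Pi.single_apply] using this

theorem exists_codimForms_one_restrictTo_le {n : ℕ}
    {W : Submodule K (MvPolynomial (Fin (n + 1)) K)} (hW : W ≤ forms K (n + 1) 1) :
    ∃ a : Fin n → K,
      codimForms 1 (W.map (restrictTo a).toLinearMap) ≤ codimForms 1 W - 1 := by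
  by_cases h : forms K (n + 1) 1 ≤ W
  · obtain rfl := le_antisymm hW h
    have := codimForms_eq_add (0 : Fin n → K) hW
    refine ⟨0, ?_⟩
    have h0 : codimForms 1 (forms K (n + 1) 1) = 0 := Nat.sub_self _
    rw [zero_add] at this
    omega
  · obtain ⟨a, ha⟩ := exists_hyperplaneForm_notMem h
    refine ⟨a, ?_⟩
    have h1 := codimForms_eq_add a hW
    have h2 : colonForms (hyperplaneForm a) W 0 = ⊥ := by
      rw [eq_bot_iff]
      rintro p ⟨hp, hp0⟩
      rw [SetLike.mem_coe, forms, homogeneousSubmodule_zero, Submodule.mem_one] at hp0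
      obtain ⟨c, rfl⟩ := hp0
      have hc : c • hyperplaneForm a ∈ W := by
        rw [Algebra.smul_def, mul_comm]
        exact hp
      by_contra hne
      refine ha ((W.smul_mem_iff ?_).mp hc)
      rintro rfl
      simp at hne
    have h3 : codimForms 0 (colonForms (hyperplaneForm a) W 0) = 1 := by
      rw [h2, codimForms, finrank_forms_zero, finrank_bot]
    rw [h3] at h1
    exact (Nat.sub_eq_of_eq_add h1).ge

theorem restrictTo_hyperplaneForm_of_eq {n : ℕ} {a b : Fin n → K} :
    restrictTo a (hyperplaneForm b) = linearForm (a - b) := by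
  rw [hyperplaneForm_eq, map_sub, restrictTo_X_zero, restrictTo_rename, sub_eq_iff_eq_add,
    ← linearForm_add, sub_add_cancel]

/-- **Green's hyperplane restriction theorem.** -/
theorem exists_codimForms_restrictTo_le [Infinite K] {n d : ℕ}
    {W : Submodule K (MvPolynomial (Fin (n + 1)) K)} (hW : W ≤ forms K (n + 1) (d + 1)) :
    ∃ a : Fin n → K, codimForms (d + 1) (W.map (restrictTo a).toLinearMap) ≤
      greenTransform (d + 1) (codimForms (d + 1) W) := by
  induction d generalizing n with
  | zero =>
    rw [zero_add, greenTransform_one]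
    exact exists_codimForms_one_restrictTo_le hW
  | succ d ihd =>
  induction n with
  | zero => exact ⟨0, by rw [codimForms_zero_vars]; exact Nat.zero_le _⟩
  | succ n ihn =>
  let f : (Fin (n + 1) → K) → ℕ := fun a => codimForms (d + 2) (W.map (restrictTo a).toLinearMap)
  obtain ⟨a₀, ha₀⟩ : ∃ a₀, ∀ a, f a₀ ≤ f a :=
    ⟨Function.argmin f, fun a => Function.argmin_le f a⟩
  obtain ⟨b₀, hb₀⟩ := ihn (map_restrictTo_le a₀ hW)
  let U := colonForms (hyperplaneForm a₀) W (d + 1)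
  have hU : U ≤ forms K (n + 2) (d + 1) := colonForms_le
  let α : (Fin n → K) × K → Fin (n + 1) → K := fun x => a₀ + x.2 • Fin.cons 1 (-x.1)
  have hfst (i) : PolyOnLines K (fun x : (Fin n → K) × K => x.1 i) :=
    PolyOnLines.linear (LinearMap.proj (R := K) (φ := fun _ => K) i ∘ₗ LinearMap.fst K _ K)
  have hsnd : PolyOnLines K (fun x : (Fin n → K) × K => x.2) :=
    fun x v => PolyOnLines.linear (LinearMap.snd K (Fin n → K) K) x v
  have hα : LinearlyParametrized (fun x => restrictTo (α x)) := by
    refine linearlyParametrized_restrictTo fun i => ?_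
    refine Fin.cases ?_ (fun i => ?_) i
    · simpa [α] using (PolyOnLines.const (a₀ 0)).add hsnd
    · have := (PolyOnLines.const (a₀ i.succ)).add
        (hsnd.mul ((PolyOnLines.const (-1)).mul (hfst i)))
      simpa [α] using this
  have hβ := (linearlyParametrized_restrictTo hfst).comp hα
  have open₁ := hα.lineOpen hW (d + 2) (f a₀)
  have open₂ := hβ.lineOpen hW (d + 2) (greenTransform (d + 2) (f a₀))
  have open₃ := hα.lineOpen hU (d + 1) (greenTransform (d + 1) (codimForms (d + 1) U))
  have open₄ := hsnd.lineOpen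
  have hα0 : α (b₀, 0) = a₀ := by simp [α]
  have ne₁ : (b₀, (0 : K)) ∈
      {x | codimForms (d + 2) (W.map (restrictTo (α x)).toLinearMap) ≤ f a₀} ∩
      {x | codimForms (d + 2) (W.map ((restrictTo x.1).comp (restrictTo (α x))).toLinearMap) ≤
        greenTransform (d + 2) (f a₀)} := by
    refine ⟨?_, ?_⟩
    · show codimForms _ (W.map (restrictTo (α (b₀, 0))).toLinearMap) ≤ _
      rw [hα0]
    · show codimForms _ (W.map ((restrictTo b₀).comp (restrictTo (α (b₀, 0)))).toLinearMap) ≤ _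
      rw [hα0, AlgHom.comp_toLinearMap, Submodule.map_comp]
      exact hb₀
  have ne₂ : ({x | codimForms (d + 1) (U.map (restrictTo (α x)).toLinearMap) ≤
        greenTransform (d + 1) (codimForms (d + 1) U)} ∩ {x | x.2 ≠ 0}).Nonempty := by
    have hline : PolyOnLines K (fun a : Fin (n + 1) → K => a 0 - a₀ 0) := by
      simpa [sub_eq_add_neg] using (PolyOnLines.linear
        (LinearMap.proj (R := K) (φ := fun _ : Fin (n + 1) => K) 0)).add
        (PolyOnLines.const (-a₀ 0))
    obtain ⟨a, ha, ha0⟩ := (lineOpen_codimForms_restrictTo hU _ _).inter_nonempty hline.lineOpen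
      (ihd hU) ⟨a₀ + 1, by simp⟩
    have ha0 : a 0 - a₀ 0 ≠ 0 := ha0
    refine ⟨(fun i => -((a 0 - a₀ 0)⁻¹ * (a i.succ - a₀ i.succ)), a 0 - a₀ 0), ?_, ha0⟩
    have : α (fun i => -((a 0 - a₀ 0)⁻¹ * (a i.succ - a₀ i.succ)), a 0 - a₀ 0) = a := by
      funext i
      refine Fin.cases ?_ (fun i => ?_) i
      · simp [α]
      · simp [α, mul_inv_cancel_left₀ ha0]
    show codimForms _ (U.map (restrictTo (α _)).toLinearMap) ≤ _
    rw [this]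
    exact ha
  obtain ⟨⟨b, t⟩, ⟨h₁, h₂⟩, h₃, h₄⟩ :=
    (open₁.inter open₂).inter_nonempty (open₃.inter open₄) ⟨_, ne₁⟩ ne₂
  have h₁ : f (α (b, t)) ≤ f a₀ := h₁
  have h₂ : codimForms (d + 2) (W.map ((restrictTo b).comp (restrictTo (α (b, t)))).toLinearMap) ≤
    greenTransform (d + 2) (f a₀) := h₂
  have h₃ : codimForms (d + 1) (U.map (restrictTo (α (b, t))).toLinearMap) ≤
    greenTransform (d + 1) (codimForms (d + 1) U) := h₃
  have h₄ : t ≠ 0 := h₄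
  refine ⟨α (b, t), ?_⟩
  set a := α (b, t) with ha
  have hfa : f a = f a₀ := le_antisymm h₁ (ha₀ a)
  have hle : U.map (restrictTo a).toLinearMap ≤
      colonForms (hyperplaneForm b) (W.map (restrictTo a).toLinearMap) (d + 1) := by
    rintro _ ⟨u, hu, rfl⟩
    refine mem_colonForms.mpr ⟨?_, restrictTo_mem a hu.2⟩
    have h := Submodule.mem_map_of_mem (f := (restrictTo a).toLinearMap) (mem_colonForms.mp hu).1
    have hab : a - a₀ = t • Fin.cons 1 (-b) := by simp [ha, α]
    rw [AlgHom.toLinearMap_apply, map_mul, restrictTo_hyperplaneForm_of_eq, hab, linearForm_smul,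
      smul_mul_assoc] at h
    exact ((W.map (restrictTo a).toLinearMap).smul_mem_iff h₄).mp h
  have e₁ := codimForms_eq_add a₀ hW
  have e₂ := codimForms_eq_add b (map_restrictTo_le a hW)
  have e₃ := codimForms_anti hle colonForms_le
  rw [AlgHom.comp_toLinearMap, Submodule.map_comp] at h₂
  have key : f a ≤
      greenTransform (d + 2) (f a) + greenTransform (d + 1) (codimForms (d + 1) U) := by
    have h₂' := h₂
    rw [← hfa] at h₂'
    exact e₂.le.trans (Nat.add_le_add h₂' (e₃.trans h₃))
  have := le_greenTransform_of_le_add key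
  rw [hfa] at this
  show f a ≤ _
  rw [hfa]
  exact this.trans_eq (congrArg _ e₁.symm)

end Green

section Macaulay

open MvPolynomial

variable {K : Type*} [Field K] {n d : ℕ}

theorem forms_mul_le {W : Submodule K (MvPolynomial (Fin n) K)} (hW : W ≤ forms K n (d + 1))
    (s : ℕ) : forms K n s * W ≤ forms K n (d + s + 1) := by
  rw [show d + s + 1 = s + (d + 1) by ring, ← forms_mul_forms]
  exact mul_le_mul_right hW _

theorem le_colonForms_forms_mul (a : Fin n → K) {W : Submodule K (MvPolynomial (Fin (n + 1)) K)}
    (hW : W ≤ forms K (n + 1) (d + 1)) :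
    W ≤ colonForms (hyperplaneForm a) (forms K (n + 1) 1 * W) (d + 1) := fun _ hp =>
  mem_colonForms.mpr ⟨Submodule.mul_mem_mul (hyperplaneForm_mem a) hp, hW hp⟩

/-- **Macaulay's bound** for the growth of the codimension of a space of forms. -/
theorem codimForms_forms_mul_le [Infinite K] {W : Submodule K (MvPolynomial (Fin n) K)}
    (hW : W ≤ forms K n (d + 1)) :
    codimForms (d + 2) (forms K n 1 * W) ≤ macaulayTransform (d + 1) (codimForms (d + 1) W) := by
  cases n with
  | zero => exact (codimForms_zero_vars _ _).le.trans (Nat.zero_le _)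
  | succ n =>
  have hW1 := forms_mul_le hW 1
  obtain ⟨a, ha⟩ := exists_codimForms_restrictTo_le hW1
  have h1 := codimForms_eq_add a hW1
  have h2 := codimForms_anti (le_colonForms_forms_mul a hW) colonForms_le
  refine le_macaulayTransform_of_le_add (fun h => absurd h d.succ_ne_zero) ?_
  exact h1.le.trans ((Nat.add_le_add ha h2).trans_eq (Nat.add_comm _ _))

end Macaulay

section LinearSyzygies

open MvPolynomial

variable {K : Type*} [Field K] {n d : ℕ} {ι : Type*} [Fintype ι]

/-- The multiples, by forms of degree `j`, of the linear syzygies of a family of polynomials. -/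
noncomputable def linearSyzygies (g : ι → MvPolynomial (Fin n) K) (j : ℕ) :
    Submodule K (ι → MvPolynomial (Fin n) K) :=
  Submodule.span K {v | ∃ m ∈ forms K n j, ∃ l : ι → MvPolynomial (Fin n) K,
    (∀ i, l i ∈ forms K n 1) ∧ ∑ i, l i * g i = 0 ∧ v = fun i => m * l i}

theorem mem_forms_of_mem_linearSyzygies {g v : ι → MvPolynomial (Fin n) K} {j : ℕ}
    (hv : v ∈ linearSyzygies g j) (i : ι) : v i ∈ forms K n (j + 1) := by
  induction hv using Submodule.span_induction with
  | mem v hv =>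
    obtain ⟨m, hm, l, hl, -, rfl⟩ := hv
    rw [← forms_mul_forms]
    exact Submodule.mul_mem_mul hm (hl i)
  | zero => exact Submodule.zero_mem _
  | add v w _ _ hv hw => exact Submodule.add_mem _ hv hw
  | smul c v _ hv => exact Submodule.smul_mem _ c hv

theorem sum_mul_eq_zero_of_mem_linearSyzygies {g v : ι → MvPolynomial (Fin n) K} {j : ℕ}
    (hv : v ∈ linearSyzygies g j) : ∑ i, v i * g i = 0 := by
  induction hv using Submodule.span_induction with
  | mem v hv =>
    obtain ⟨m, -, l, -, h, rfl⟩ := hv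
    simp only [mul_assoc, ← Finset.mul_sum, h, mul_zero]
  | zero => simp
  | add v w _ _ hv hw => simp [add_mul, Finset.sum_add_distrib, hv, hw]
  | smul c v _ hv => simp [← Finset.smul_sum, hv]

theorem mul_mem_linearSyzygies {g v : ι → MvPolynomial (Fin n) K} {j : ℕ}
    {h : MvPolynomial (Fin n) K} (hh : h ∈ forms K n 1) (hv : v ∈ linearSyzygies g j) :
    h • v ∈ linearSyzygies g (j + 1) := by
  induction hv using Submodule.span_induction with
  | mem v hv =>
    obtain ⟨m, hm, l, hl, h0, rfl⟩ := hv
    refine Submodule.subset_span ⟨h * m, ?_, l, hl, h0, by funext i; simp [mul_assoc]⟩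
    rw [add_comm, ← forms_mul_forms]
    exact Submodule.mul_mem_mul hh hm
  | zero => exact (smul_zero (A := ι → MvPolynomial (Fin n) K) h).symm ▸ Submodule.zero_mem _
  | add v w _ _ hv hw => exact (smul_add h v w).symm ▸ Submodule.add_mem _ hv hw
  | smul c v _ hv => exact (smul_comm h c v).symm ▸ Submodule.smul_mem _ c hv

theorem mem_linearSyzygies_zero {g a : ι → MvPolynomial (Fin n) K} (ha : ∀ i, a i ∈ forms K n 1)
    (h : ∑ i, a i * g i = 0) : a ∈ linearSyzygies g 0 :=
  Submodule.subset_span ⟨1, isHomogeneous_one _ _, a, ha, h, by simp⟩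

theorem exists_eq_sum_of_mem_forms_mul {g : ι → MvPolynomial (Fin n) K}
    {s : ℕ} {p : MvPolynomial (Fin n) K}
    (hp : p ∈ forms K n s * Submodule.span K (Set.range g)) :
    ∃ b : ι → MvPolynomial (Fin n) K, (∀ i, b i ∈ forms K n s) ∧ p = ∑ i, b i * g i := by
  induction hp using Submodule.mul_induction_on' with
  | mem_mul_mem m hm w hw =>
    obtain ⟨c, rfl⟩ := (Submodule.mem_span_range_iff_exists_fun K).mp hw
    exact ⟨fun i => c i • m, fun i => Submodule.smul_mem _ _ hm, by simp [Finset.mul_sum]⟩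
  | add p _ q _ hp hq =>
    obtain ⟨b, hb, rfl⟩ := hp
    obtain ⟨b', hb', rfl⟩ := hq
    exact ⟨fun i => b i + b' i, fun i => Submodule.add_mem _ (hb i) (hb' i),
      by simp [add_mul, Finset.sum_add_distrib]⟩

theorem sum_mul_mem_forms_mul {g b : ι → MvPolynomial (Fin n) K} {s : ℕ}
    (hb : ∀ i, b i ∈ forms K n s) :
    ∑ i, b i * g i ∈ forms K n s * Submodule.span K (Set.range g) :=
  Submodule.sum_mem _ fun i _ => Submodule.mul_mem_mul (hb i) (Submodule.subset_span ⟨i, rfl⟩)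

theorem map_restrictTo_forms_mul (a : Fin n → K) (s : ℕ)
    (W : Submodule K (MvPolynomial (Fin (n + 1)) K)) :
    (forms K (n + 1) s * W).map (restrictTo a).toLinearMap =
      forms K n s * W.map (restrictTo a).toLinearMap := by
  rw [Submodule.map_mul, map_restrictTo_forms]

theorem map_restrictTo_span_range {ι : Type*} (a : Fin n → K)
    (g : ι → MvPolynomial (Fin (n + 1)) K) :
    (Submodule.span K (Set.range g)).map (restrictTo a).toLinearMap =
      Submodule.span K (Set.range fun i => restrictTo a (g i)) := by
  rw [Submodule.map_span, ← Set.range_comp]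
  rfl

theorem exists_linearSyzygies_lift {a : Fin n → K} {g : ι → MvPolynomial (Fin (n + 1)) K}
    (hg : Submodule.span K (Set.range g) ≤ forms K (n + 1) (d + 1))
    (hcolon : colonForms (hyperplaneForm a)
      (forms K (n + 1) 1 * Submodule.span K (Set.range g)) (d + 1) ≤
        Submodule.span K (Set.range g))
    {j : ℕ} {v : ι → MvPolynomial (Fin n) K}
    (hv : v ∈ linearSyzygies (fun i => restrictTo a (g i)) j) :
    ∃ w ∈ linearSyzygies g j, ∀ i, restrictTo a (w i) = v i := by
  induction hv using Submodule.span_induction with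
  | mem v hv =>
    obtain ⟨m, hm, l, hl, h0, rfl⟩ := hv
    have hmem := sum_mul_mem_forms_mul (g := g) fun i => rename_succ_mem (hl i)
    obtain ⟨f, hf, hpf⟩ := exists_eq_hyperplaneForm_mul (a := a) (forms_mul_le hg 1 hmem)
      (by simpa using h0)
    have hfW := hcolon (mem_colonForms.mpr ⟨hpf ▸ hmem, hf⟩)
    obtain ⟨c, rfl⟩ := (Submodule.mem_span_range_iff_exists_fun K).mp hfW
    refine ⟨fun i => rename Fin.succ m * (rename Fin.succ (l i) - c i • hyperplaneForm a),
      Submodule.subset_span ⟨_, rename_succ_mem hm, _, fun i => Submodule.sub_mem _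
        (rename_succ_mem (hl i)) (Submodule.smul_mem _ _ (hyperplaneForm_mem a)), ?_, rfl⟩, ?_⟩
    · simp only [sub_mul, Finset.sum_sub_distrib, hpf, Finset.mul_sum, smul_mul_assoc,
        mul_smul_comm, sub_self]
    · simp [restrictTo_hyperplaneForm]
  | zero => exact ⟨0, Submodule.zero_mem _, by simp⟩
  | add v w _ _ hv hw =>
    obtain ⟨v', hv', hv⟩ := hv
    obtain ⟨w', hw', hw⟩ := hw
    exact ⟨v' + w', Submodule.add_mem _ hv' hw', by simp [hv, hw]⟩
  | smul c v _ hv =>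
    obtain ⟨v', hv', hv⟩ := hv
    exact ⟨c • v', Submodule.smul_mem _ c hv', by simp [hv]⟩

/-- All syzygies of `g` with coefficients of positive degree come from linear ones. -/
def HasLinearSyzygies (g : ι → MvPolynomial (Fin n) K) : Prop :=
  ∀ (j : ℕ) (a : ι → MvPolynomial (Fin n) K), (∀ i, a i ∈ forms K n (j + 1)) →
    ∑ i, a i * g i = 0 → a ∈ linearSyzygies g j

theorem exists_sub_mem_linearSyzygies {a : Fin n → K} {g : ι → MvPolynomial (Fin (n + 1)) K}
    (hg : Submodule.span K (Set.range g) ≤ forms K (n + 1) (d + 1))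
    (hcolon : colonForms (hyperplaneForm a)
      (forms K (n + 1) 1 * Submodule.span K (Set.range g)) (d + 1) ≤
        Submodule.span K (Set.range g))
    (hsyz : HasLinearSyzygies fun i => restrictTo a (g i))
    {j : ℕ} {v : ι → MvPolynomial (Fin (n + 1)) K} (hv : ∀ i, v i ∈ forms K (n + 1) (j + 1))
    (h0 : restrictTo a (∑ i, v i * g i) = 0) :
    ∃ b : ι → MvPolynomial (Fin (n + 1)) K, (∀ i, b i ∈ forms K (n + 1) j) ∧
      ∑ i, v i * g i = hyperplaneForm a * ∑ i, b i * g i ∧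
      v - hyperplaneForm a • b ∈ linearSyzygies g j := by
  obtain ⟨w, hw, hwv⟩ := exists_linearSyzygies_lift hg hcolon
    (hsyz j (fun i => restrictTo a (v i)) (fun i => restrictTo_mem a (hv i)) (by simpa using h0))
  choose b hb hvb using fun i => exists_eq_hyperplaneForm_mul (a := a) (p := v i - w i)
    (Submodule.sub_mem _ (hv i) (mem_forms_of_mem_linearSyzygies hw i)) (by simp [hwv])
  have hvw : v - hyperplaneForm a • b = w := by
    funext i
    rw [Pi.sub_apply, Pi.smul_apply, smul_eq_mul, ← hvb, sub_sub_cancel]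
  refine ⟨b, hb, ?_, hvw ▸ hw⟩
  have := sum_mul_eq_zero_of_mem_linearSyzygies hw
  rw [← hvw] at this
  simp only [Pi.sub_apply, Pi.smul_apply, smul_eq_mul, sub_mul, Finset.sum_sub_distrib,
    sub_eq_zero] at this
  simpa only [Finset.mul_sum, mul_assoc] using this

theorem hasLinearSyzygies_of_restrictTo {a : Fin n → K} {g : ι → MvPolynomial (Fin (n + 1)) K}
    (hg : Submodule.span K (Set.range g) ≤ forms K (n + 1) (d + 1))
    (hcolon : colonForms (hyperplaneForm a)
      (forms K (n + 1) 1 * Submodule.span K (Set.range g)) (d + 1) ≤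
        Submodule.span K (Set.range g))
    (hsyz : HasLinearSyzygies fun i => restrictTo a (g i)) : HasLinearSyzygies g := by
  intro j
  induction j with
  | zero => exact fun v hv h0 => mem_linearSyzygies_zero hv h0
  | succ j ih =>
    intro v hv h0
    obtain ⟨b, hb, h1, h2⟩ := exists_sub_mem_linearSyzygies hg hcolon hsyz hv (by simp [h0])
    rw [h0, zero_eq_mul, or_iff_right (hyperplaneForm_ne_zero a)] at h1
    simpa using Submodule.add_mem _ h2
      (mul_mem_linearSyzygies (hyperplaneForm_mem a) (ih b hb h1))

theorem colonForms_forms_mul_eq {a : Fin n → K} {g : ι → MvPolynomial (Fin (n + 1)) K}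
    (hg : Submodule.span K (Set.range g) ≤ forms K (n + 1) (d + 1))
    (hcolon : colonForms (hyperplaneForm a)
      (forms K (n + 1) 1 * Submodule.span K (Set.range g)) (d + 1) ≤
        Submodule.span K (Set.range g))
    (hsyz : HasLinearSyzygies fun i => restrictTo a (g i)) (s : ℕ) :
    colonForms (hyperplaneForm a)
      (forms K (n + 1) (s + 1) * Submodule.span K (Set.range g)) (d + s + 1) =
        forms K (n + 1) s * Submodule.span K (Set.range g) := by
  apply le_antisymm
  · rintro f hf
    obtain ⟨v, hv, hfv⟩ := exists_eq_sum_of_mem_forms_mul (mem_colonForms.mp hf).1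
    obtain ⟨b, hb, h1, -⟩ := exists_sub_mem_linearSyzygies hg hcolon hsyz hv
      (by rw [← hfv, map_mul, restrictTo_hyperplaneForm, zero_mul])
    rw [← hfv] at h1
    rw [mul_left_cancel₀ (hyperplaneForm_ne_zero a) h1]
    exact sum_mul_mem_forms_mul hb
  · intro f hf
    refine mem_colonForms.mpr ⟨?_, forms_mul_le hg s hf⟩
    rw [add_comm s 1, ← forms_mul_forms, mul_assoc]
    exact Submodule.mul_mem_mul (hyperplaneForm_mem a) hf

theorem codimForms_persistence_and_hasLinearSyzygies [Infinite K] {g : ι → MvPolynomial (Fin n) K}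
    (hg : Submodule.span K (Set.range g) ≤ forms K n (d + 1))
    (hmax : codimForms (d + 2) (forms K n 1 * Submodule.span K (Set.range g)) =
      macaulayTransform (d + 1) (codimForms (d + 1) (Submodule.span K (Set.range g)))) :
    (∀ s, codimForms (d + s + 2) (forms K n (s + 1) * Submodule.span K (Set.range g)) =
      macaulayTransform (d + s + 1)
        (codimForms (d + s + 1) (forms K n s * Submodule.span K (Set.range g)))) ∧
    HasLinearSyzygies g := by
  induction n with
  | zero =>
    refine ⟨fun s => by simp only [codimForms_zero_vars, macaulayTransform_zero_right],
      fun j v hv _ => ?_⟩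
    have : v = 0 := by
      funext i
      have := hv i
      rwa [forms_zero_vars, Submodule.mem_bot] at this
    exact this ▸ Submodule.zero_mem _
  | succ n ih =>
  set W := Submodule.span K (Set.range g) with hWdef
  have hW1 := forms_mul_le hg 1
  obtain ⟨a, hb, hb1⟩ := (lineOpen_codimForms_restrictTo hg _ _).inter_nonempty
    (lineOpen_codimForms_restrictTo hW1 _ _)
    (exists_codimForms_restrictTo_le hg) (exists_codimForms_restrictTo_le hW1)
  have hb : codimForms (d + 1) (W.map (restrictTo a).toLinearMap) ≤
    greenTransform (d + 1) (codimForms (d + 1) W) := hb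
  have hb1 : codimForms (d + 2) ((forms K (n + 1) 1 * W).map (restrictTo a).toLinearMap) ≤
    greenTransform (d + 2) (codimForms (d + 2) (forms K (n + 1) 1 * W)) := hb1
  have hle := le_colonForms_forms_mul a hg
  have hsum := codimForms_eq_add a hW1
  have hanti := codimForms_anti hle colonForms_le
  have hE : ∀ e c, macaulayTransform (e + 1) c =
      c + greenTransform (e + 2) (macaulayTransform (e + 1) c) := fun e c =>
    macaulayTransform_eq_add_greenTransform fun h => absurd h e.succ_ne_zero
  have hE1 := hE d (codimForms (d + 1) W)
  rw [← hmax] at hE1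
  have hcolon : colonForms (hyperplaneForm a) (forms K (n + 1) 1 * W) (d + 1) = W := by
    have := finiteDimensional_of_le_forms
      (colonForms_le (h := hyperplaneForm a) (W := forms K (n + 1) 1 * W) (d := d + 1))
    refine (Submodule.eq_of_le_of_finrank_le hle ?_).symm
    have h1 := finrank_add_codimForms hg
    have h2 := finrank_add_codimForms
      (colonForms_le (h := hyperplaneForm a) (W := forms K (n + 1) 1 * W) (d := d + 1))
    simp only [add_assoc, Nat.reduceAdd] at *
    omega
  have hb1' : codimForms (d + 2) ((forms K (n + 1) 1 * W).map (restrictTo a).toLinearMap) =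
      greenTransform (d + 2) (codimForms (d + 2) (forms K (n + 1) 1 * W)) := by
    refine hb1.antisymm ?_
    rw [hcolon] at hsum
    simp only [add_assoc, Nat.reduceAdd] at *
    omega
  have hφW := map_restrictTo_le a hg
  have hmax' : codimForms (d + 2) (forms K n 1 * W.map (restrictTo a).toLinearMap) =
      macaulayTransform (d + 1) (codimForms (d + 1) (W.map (restrictTo a).toLinearMap)) := by
    refine (codimForms_forms_mul_le hφW).antisymm ?_
    rw [← map_restrictTo_forms_mul, hb1', hmax, ← macaulayTransform_greenTransform]
    exact macaulayTransform_mono _ hb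
  rw [hWdef, map_restrictTo_span_range] at hφW hmax'
  obtain ⟨hpers, hsyz⟩ := ih hφW hmax'
  refine ⟨?_, hasLinearSyzygies_of_restrictTo hg hcolon.le hsyz⟩
  have hstep (s : ℕ) : codimForms (d + s + 2) (forms K (n + 1) (s + 1) * W) =
      codimForms (d + s + 2) ((forms K (n + 1) (s + 1) * W).map (restrictTo a).toLinearMap) +
        codimForms (d + s + 1) (forms K (n + 1) s * W) := by
    rw [← colonForms_forms_mul_eq hg hcolon.le hsyz s]
    exact codimForms_eq_add a (forms_mul_le hg (s + 1))
  have hmap (s : ℕ) : (forms K (n + 1) s * W).map (restrictTo a).toLinearMap =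
      forms K n s * Submodule.span K (Set.range fun i => restrictTo a (g i)) := by
    rw [map_restrictTo_forms_mul, map_restrictTo_span_range]
  suffices h : ∀ s, codimForms (d + s + 2) (forms K (n + 1) (s + 1) * W) =
        macaulayTransform (d + s + 1) (codimForms (d + s + 1) (forms K (n + 1) s * W)) ∧
      codimForms (d + s + 2) ((forms K (n + 1) (s + 1) * W).map (restrictTo a).toLinearMap) =
        greenTransform (d + s + 2) (codimForms (d + s + 2) (forms K (n + 1) (s + 1) * W)) from
    fun s => (h s).1
  intro s
  induction s with
  | zero =>
    refine ⟨?_, hb1'⟩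
    have h0 : forms K (n + 1) 0 = 1 := homogeneousSubmodule_zero _
    rw [h0, one_mul]
    exact hmax
  | succ s ihs =>
    have h1 : codimForms (d + (s + 1) + 2)
        ((forms K (n + 1) (s + 1 + 1) * W).map (restrictTo a).toLinearMap) =
        greenTransform (d + (s + 1) + 2) (macaulayTransform (d + (s + 1) + 1)
          (codimForms (d + (s + 1) + 1) (forms K (n + 1) (s + 1) * W))) := by
      rw [hmap, hpers (s + 1), ← hmap, ← macaulayTransform_greenTransform]
      exact congrArg _ ihs.2
    have h2 := hstep (s + 1)
    rw [h1, Nat.add_comm (greenTransform _ _), ← hE] at h2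
    exact ⟨h2, h1.trans (by rw [h2])⟩

/-- Persistence for spaces of forms over an infinite field. -/
theorem codimForms_persistence_of_infinite [Infinite K] {W : Submodule K (MvPolynomial (Fin n) K)}
    (hW : W ≤ forms K n (d + 1))
    (hmax : codimForms (d + 2) (forms K n 1 * W) =
      macaulayTransform (d + 1) (codimForms (d + 1) W)) (s : ℕ) :
    codimForms (d + s + 2) (forms K n (s + 1) * W) =
      macaulayTransform (d + s + 1) (codimForms (d + s + 1) (forms K n s * W)) := by
  have := finiteDimensional_of_le_forms hW
  obtain ⟨k, g, rfl⟩ := Submodule.fg_iff_exists_fin_generating_family.mp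
    (Module.Finite.iff_fg.mp this)
  exact (codimForms_persistence_and_hasLinearSyzygies hW hmax).1 s

end LinearSyzygies

section ExtendScalars

open MvPolynomial

variable {K : Type*} [Field K] (L : Type*) [Field L] [Algebra K L] {n d : ℕ}

/-- The space of polynomials over `L` spanned by a space of polynomials over `K`. -/
noncomputable def extendScalars (W : Submodule K (MvPolynomial (Fin n) K)) :
    Submodule L (MvPolynomial (Fin n) L) :=
  Submodule.span L (map (algebraMap K L) '' W)

theorem extendScalars_mono {V W : Submodule K (MvPolynomial (Fin n) K)} (h : V ≤ W) :
    extendScalars L V ≤ extendScalars L W :=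
  Submodule.span_mono (Set.image_mono h)

theorem extendScalars_mul (V W : Submodule K (MvPolynomial (Fin n) K)) :
    extendScalars L (V * W) = extendScalars L V * extendScalars L W := by
  rw [extendScalars, extendScalars, extendScalars, Submodule.span_mul_span]
  apply le_antisymm <;> rw [Submodule.span_le]
  · rintro _ ⟨p, hp, rfl⟩
    induction hp using Submodule.mul_induction_on' with
    | mem_mul_mem v hv w hw =>
      rw [map_mul]
      exact Submodule.subset_span (Set.mul_mem_mul ⟨v, hv, rfl⟩ ⟨w, hw, rfl⟩)
    | add p _ q _ hp hq =>
      rw [map_add]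
      exact Submodule.add_mem _ hp hq
  · rintro _ ⟨_, ⟨v, hv, rfl⟩, _, ⟨w, hw, rfl⟩, rfl⟩
    exact Submodule.subset_span ⟨v * w, Submodule.mul_mem_mul hv hw, map_mul _ _ _⟩

theorem extendScalars_forms : extendScalars L (forms K n d) = forms L n d := by
  apply le_antisymm
  · rw [extendScalars, Submodule.span_le]
    rintro _ ⟨p, hp, rfl⟩
    exact IsHomogeneous.map hp _
  · intro p hp
    rw [p.as_sum]
    refine Submodule.sum_mem _ fun m hm => ?_
    have h : monomial m (coeff m p) = coeff m p • map (algebraMap K L) (monomial m 1) := by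
      rw [map_monomial, map_one, smul_monomial, smul_eq_mul, mul_one]
    rw [h]
    refine Submodule.smul_mem _ _ (Submodule.subset_span ⟨_, ?_, rfl⟩)
    refine isHomogeneous_monomial _ ?_
    rw [Finsupp.degree_eq_weight_one]
    exact hp (mem_support_iff.mp hm)

theorem linearIndependent_map_algebraMap {ι : Type*} {v : ι → MvPolynomial (Fin n) K}
    (hv : LinearIndependent K v) :
    LinearIndependent L fun i => map (algebraMap K L) (v i) := by
  rw [linearIndependent_iff'] at hv ⊢
  intro s c hc i hi
  rw [← Module.forall_dual_apply_eq_zero_iff K]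
  intro l
  refine hv s (fun i => l (c i)) ?_ i hi
  ext m
  have h := congrArg (fun p => l (coeff m p)) hc
  simp only [coeff_sum, coeff_smul, coeff_map, smul_eq_mul, map_sum, coeff_zero, map_zero] at h ⊢
  rw [← h]
  refine Finset.sum_congr rfl fun i _ => ?_
  rw [mul_comm (c i), ← Algebra.smul_def, map_smul, smul_eq_mul, mul_comm]

theorem finrank_extendScalars {W : Submodule K (MvPolynomial (Fin n) K)}
    (hW : W ≤ forms K n d) :
    Module.finrank L (extendScalars L W) = Module.finrank K W := by
  have := finiteDimensional_of_le_forms hW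
  let b := Module.finBasis K W
  have hspan : extendScalars L W =
      Submodule.span L
        (Set.range fun i => map (algebraMap K L) (b i : MvPolynomial (Fin n) K)) := by
    apply le_antisymm <;> rw [extendScalars, Submodule.span_le]
    · rintro _ ⟨p, hp, rfl⟩
      have h := congrArg (fun w : W => map (algebraMap K L) w.1) (b.sum_repr ⟨p, hp⟩)
      simp only [Submodule.coe_sum, Submodule.coe_smul, map_sum, smul_eq_C_mul, map_mul, map_C] at h
      rw [← h]
      refine Submodule.sum_mem _ fun i _ => ?_
      rw [← smul_eq_C_mul]
      exact Submodule.smul_mem _ _ (Submodule.subset_span ⟨i, rfl⟩)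
    · rintro _ ⟨i, rfl⟩
      exact Submodule.subset_span ⟨_, (b i).2, rfl⟩
  have hb : LinearIndependent L fun i => map (algebraMap K L) (b i : MvPolynomial (Fin n) K) :=
    linearIndependent_map_algebraMap L (b.linearIndependent.map' W.subtype W.ker_subtype)
  rw [hspan, finrank_span_eq_card hb, Fintype.card_fin]

theorem codimForms_extendScalars {W : Submodule K (MvPolynomial (Fin n) K)}
    (hW : W ≤ forms K n d) : codimForms d (extendScalars L W) = codimForms d W := by
  rw [codimForms, codimForms, finrank_extendScalars L hW, ← extendScalars_forms (K := K) L,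
    finrank_extendScalars L le_rfl]

/-- Persistence for spaces of forms over an arbitrary field. -/
theorem codimForms_persistence {W : Submodule K (MvPolynomial (Fin n) K)}
    (hW : W ≤ forms K n (d + 1))
    (hmax : codimForms (d + 2) (forms K n 1 * W) =
      macaulayTransform (d + 1) (codimForms (d + 1) W)) (s : ℕ) :
    codimForms (d + s + 2) (forms K n (s + 1) * W) =
      macaulayTransform (d + s + 1) (codimForms (d + s + 1) (forms K n s * W)) := by
  let L := AlgebraicClosure K
  have : Infinite L := IsAlgClosed.instInfinite
  have hW' : extendScalars L W ≤ forms L n (d + 1) :=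
    (extendScalars_mono L hW).trans (extendScalars_forms L).le
  have key (t : ℕ) : codimForms (d + t + 1) (forms L n t * extendScalars L W) =
      codimForms (d + t + 1) (forms K n t * W) := by
    rw [← extendScalars_forms (K := K) L, ← extendScalars_mul,
      codimForms_extendScalars L (forms_mul_le hW t)]
  have h1 := codimForms_persistence_of_infinite hW'
    ((key 1).trans (hmax.trans (congrArg _ (codimForms_extendScalars L hW).symm))) s
  rw [key s] at h1
  exact (key (s + 1)).symm.trans h1

end ExtendScalars

section Ideals

open MvPolynomial

variable {K : Type*} [Field K] {n d : ℕ}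

theorem homogeneousComponent_add_mul {g : MvPolynomial (Fin n) K} {j : ℕ} (hg : g ∈ forms K n j)
    (p : MvPolynomial (Fin n) K) (i : ℕ) :
    homogeneousComponent (i + j) (p * g) = homogeneousComponent i p * g := by
  let _ := MvPolynomial.gradedAlgebra (σ := Fin n) (R := K)
  have := DirectSum.coe_decompose_mul_add_of_right_mem (homogeneousSubmodule (Fin n) K)
    (i := i) (a := p) hg
  rw [← decomposition.decompose'_apply, ← decomposition.decompose'_apply]
  exact this

theorem homogeneousComponent_mem_forms_mul {G : Set (MvPolynomial (Fin n) K)}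
    (hG : ∀ g ∈ G, ∃ j ≤ d, IsHomogeneous g j) {p : MvPolynomial (Fin n) K}
    (hp : p ∈ Ideal.span G) (s : ℕ) :
    homogeneousComponent (s + d) p ∈
      forms K n s * ((Ideal.span G).restrictScalars K ⊓ forms K n d) := by
  induction hp using Submodule.closure_induction with
  | zero => simp
  | add p q _ _ hp hq =>
    rw [map_add]
    exact Submodule.add_mem _ hp hq
  | smul_mem r g hg =>
    obtain ⟨j, hj, hgj⟩ := hG g hg
    obtain ⟨e, rfl⟩ := Nat.exists_eq_add_of_le' hj
    rw [smul_eq_mul, ← add_assoc, homogeneousComponent_add_mul hgj]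
    have hr := homogeneousComponent_mem (s + e) r
    rw [← forms, ← forms_mul_forms] at hr
    have h := Submodule.mul_mem_mul hr (Submodule.mem_span_singleton_self (R := K) g)
    rw [mul_assoc] at h
    refine (mul_le_mul_right (Submodule.mul_le.mpr fun m hm x hx => ?_) _) h
    obtain ⟨c, rfl⟩ := Submodule.mem_span_singleton.mp hx
    rw [mul_smul_comm]
    refine Submodule.smul_mem _ c ⟨Ideal.mul_mem_left _ _ (Ideal.subset_span hg), ?_⟩
    rw [SetLike.mem_coe, ← forms_mul_forms]
    exact Submodule.mul_mem_mul hm hgj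

theorem restrictScalars_inf_forms_eq {G : Set (MvPolynomial (Fin n) K)}
    (hG : ∀ g ∈ G, ∃ j ≤ d, IsHomogeneous g j) (s : ℕ) :
    (Ideal.span G).restrictScalars K ⊓ forms K n (s + d) =
      forms K n s * ((Ideal.span G).restrictScalars K ⊓ forms K n d) := by
  apply le_antisymm
  · rintro p ⟨hp, hpd⟩
    have h := homogeneousComponent_mem_forms_mul hG hp s
    rwa [homogeneousComponent_of_mem hpd, if_pos rfl] at h
  · refine Submodule.mul_le.mpr fun m hm x hx => ⟨Ideal.mul_mem_left _ _ hx.1, ?_⟩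
    rw [SetLike.mem_coe, ← forms_mul_forms]
    exact Submodule.mul_mem_mul hm hx.2

end Ideals

/-- **Gotzmann's Persistence Theorem.** Let `S = k[x_0, …, x_n]`, and `I` a
homogeneous ideal generated in degrees at most `d`, `d ≥ 1`. If
`H(S/I, d+1) = H(S/I, d)^{⟨d⟩}`, then `H(S/I, s+1) = H(S/I, s)^{⟨s⟩}` for all `s ≥ d`. -/
theorem gotzmann_persistence (K : Type) [Field K] (n d : ℕ) (hd : 1 ≤ d)
    (I : Ideal (MvPolynomial (Fin (n+1)) K))
    (hgen : ∃ G : Set (MvPolynomial (Fin (n+1)) K), I = Ideal.span G ∧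
      ∀ g ∈ G, ∃ j ≤ d, MvPolynomial.IsHomogeneous g j)
    (hpers : hilbertFnQuot K n I (d + 1) = macaulayTransform d (hilbertFnQuot K n I d)) :
    ∀ s : ℕ, d ≤ s →
      hilbertFnQuot K n I (s + 1) = macaulayTransform s (hilbertFnQuot K n I s) := by
  obtain ⟨G, rfl, hG⟩ := hgen
  obtain ⟨d, rfl⟩ := Nat.exists_eq_add_of_le' hd
  have key (t : ℕ) : hilbertFnQuot K n (Ideal.span G) (d + t + 1) =
      codimForms (d + t + 1) (forms K (n + 1) t *
        ((Ideal.span G).restrictScalars K ⊓ forms K (n + 1) (d + 1))) := by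
    rw [← restrictScalars_inf_forms_eq hG, show t + (d + 1) = d + t + 1 by ring]
    rfl
  intro s hs
  obtain ⟨t, rfl⟩ := Nat.exists_eq_add_of_le hs
  have h1 := codimForms_persistence (K := K) (n := n + 1) (d := d)
    (W := (Ideal.span G).restrictScalars K ⊓ forms K (n + 1) (d + 1)) inf_le_right
    ((key 1).symm.trans hpers) t
  rw [← key t] at h1
  rw [show d + 1 + t = d + t + 1 by ring]
  exact (key (t + 1)).trans h1
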